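/- Let n ≥ 3, r > 0, and let Ω = {x ∈ ℝⁿ : |x| > r} be the exterior of a closed ball. Then H(Ω) = 1/4; that is, ∫_Ω ‖∇u‖² dx ≥ (1/4) ∫_Ω u²/d² dx for every u ∈ C_c^∞(Ω), and 1/4 is the largest constant for which this inequality holds for all u ∈ C_c^∞(Ω). -/

import Mathlib

open MeasureTheory Real

/-- On the complement of a closed ball, the distance to the ball is `‖x‖ - r`. -/
lemma infDist_compl_exterior_ball {E : Type*} [NormedAddCommGroup E] [NormedSpace ℝ E]
    {r : ℝ} (hr : 0 < r) {x : E} (hx : r < ‖x‖) :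
    Metric.infDist x {x : E | r < ‖x‖}ᶜ = ‖x‖ - r := by
  have hx0 : 0 < ‖x‖ := hr.trans hx
  apply le_antisymm
  · have hmem : (r / ‖x‖) • x ∈ {x : E | r < ‖x‖}ᶜ := by
      simp [norm_smul, abs_of_pos hr, hx0.ne']
    refine (Metric.infDist_le_dist_of_mem hmem).trans_eq ?_
    have : x - (r / ‖x‖) • x = (1 - r / ‖x‖) • x := by rw [sub_smul, one_smul]
    rw [dist_eq_norm, this, norm_smul, Real.norm_eq_abs, abs_of_nonneg]
    · field_simp
    · rw [sub_nonneg, div_le_one hx0]; exact hx.le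
  · rw [Metric.le_infDist ⟨0, by simp [hr.le]⟩]
    intro y hy
    have hy' : ‖y‖ ≤ r := by simpa using hy
    have := norm_sub_norm_le x y
    rw [dist_eq_norm]
    linarith

/-- Integration in polar coordinates: a function with nonnegative weighted integral along every
ray from the origin has nonnegative integral. -/
lemma integral_nonneg_of_forall_ray {E : Type*} [NormedAddCommGroup E] [NormedSpace ℝ E]
    [FiniteDimensional ℝ E] [Nontrivial E] [MeasurableSpace E] [BorelSpace E] (μ : Measure E)
    [μ.IsAddHaarMeasure] {f : E → ℝ} (hf : Integrable f μ)
    (h : ∀ w : E, ‖w‖ = 1 →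
      0 ≤ ∫ y in Set.Ioi (0 : ℝ), y ^ (Module.finrank ℝ E - 1) * f (y • w)) :
    0 ≤ ∫ x, f x ∂μ := by
  have hmp := μ.measurePreserving_homeomorphUnitSphereProd
  have hemb := (homeomorphUnitSphereProd E).measurableEmbedding
  let F : Metric.sphere (0 : E) 1 × Set.Ioi (0 : ℝ) → ℝ := fun p ↦ f (p.2.1 • p.1.1)
  have hF : ∀ x : ({0}ᶜ : Set E), F (homeomorphUnitSphereProd E x) = f x := by
    intro x
    have hx : ‖x.1‖ ≠ 0 := norm_ne_zero_iff.2 x.2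
    simp [F, hx]
  have hint : Integrable F (μ.toSphere.prod (.volumeIoiPow (Module.finrank ℝ E - 1))) := by
    rw [← hmp.integrable_comp_emb hemb]
    have : F ∘ homeomorphUnitSphereProd E = f ∘ Subtype.val := funext hF
    rw [this, ← integrableOn_iff_comap_subtypeVal (measurableSet_singleton _).compl]
    exact hf.integrableOn
  have key : ∫ x, f x ∂μ
      = ∫ p, F p ∂μ.toSphere.prod (.volumeIoiPow (Module.finrank ℝ E - 1)) := by
    rw [← hmp.integral_comp hemb]
    simp_rw [hF]
    rw [integral_subtype_comap (measurableSet_singleton _).compl f, restrict_compl_singleton]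
  rw [key, integral_prod _ hint]
  refine integral_nonneg fun w ↦ ?_
  have hw := h w.1 (by simp)
  simp only [Measure.volumeIoiPow, ENNReal.ofReal]
  rw [integral_withDensity_eq_integral_smul,
    integral_subtype_comap measurableSet_Ioi
      fun y ↦ Real.toNNReal (y ^ (Module.finrank ℝ E - 1)) • f (y • w.1),
    setIntegral_congr_fun measurableSet_Ioi fun y hy ↦ ?_]
  · exact hw
  · simp only [NNReal.smul_def, smul_eq_mul]
    rw [Real.coe_toNNReal _ (pow_nonneg (le_of_lt hy) _)]
  · exact (measurable_subtype_coe.pow_const _).real_toNNReal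

/-- The derivative of `y ^ (k + 2) * F y * g y ^ 2`, where `F` is the logarithmic derivative of
`y ^ (-(k + 2) / 2) * (y - r) ^ (1 / 2)`, is bounded by the one-dimensional Hardy integrand. -/
lemma exists_hasDerivAt_le_radial_hardy (k : ℕ) {r y q' : ℝ} (hr : 0 < r) (hy : r < y)
    {g : ℝ → ℝ} (hg : HasDerivAt g q' y) :
    ∃ D : ℝ, HasDerivAt (fun y ↦ y ^ (k + 2) *
        (-((k : ℝ) + 2) / 2 * y⁻¹ + 1 / 2 * (y - r)⁻¹) * g y ^ 2) D y ∧
      D ≤ y ^ (k + 2) * (q' ^ 2 - 1 / 4 * (g y ^ 2 / (y - r) ^ 2)) := by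
  have hy0 : 0 < y := hr.trans hy
  have hd : 0 < y - r := sub_pos.2 hy
  have h1 := ((hasDerivAt_pow (k + 2) y).mul (((hasDerivAt_inv hy0.ne').const_mul
    (-((k : ℝ) + 2) / 2)).add ((((hasDerivAt_id y).sub_const r).inv hd.ne').const_mul
    (1 / 2)))).mul (hg.pow 2)
  refine ⟨_, h1, ?_⟩
  rw [← sub_nonneg]
  have key : 0 ≤ y ^ (k + 2) * ((q' - (-((k : ℝ) + 2) / 2 * y⁻¹ + 1 / 2 * (y - r)⁻¹) * g y) ^ 2
      + ((k : ℝ) + 2) * k / (4 * y ^ 2) * g y ^ 2) := by positivity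
  convert key using 1
  simp only [Pi.add_apply, Pi.mul_apply, Pi.pow_apply, id, Pi.inv_apply]
  generalize g y = q
  push_cast
  field_simp
  ring

section Exterior

variable {E : Type*} [NormedAddCommGroup E]

lemma isOpen_exterior_ball (r : ℝ) : IsOpen {x : E | r < ‖x‖} :=
  isOpen_lt continuous_const continuous_norm

lemma hasCompactSupport_sq_div {u : E → ℝ} (hc : HasCompactSupport u) (v : E → ℝ) :
    HasCompactSupport fun x ↦ u x ^ 2 / v x :=
  HasCompactSupport.intro hc fun x hx ↦ by simp [image_eq_zero_of_notMem_tsupport hx]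

/-- A compact subset of the exterior of a ball is contained in a compact annulus. -/
lemma exists_annulus_of_isCompact {K : Set E} (hK : IsCompact K) {r : ℝ}
    (hs : K ⊆ {x : E | r < ‖x‖}) :
    ∃ a b, r < a ∧ a < b ∧ ∀ x ∈ K, a < ‖x‖ ∧ ‖x‖ < b := by
  obtain ⟨b, hb⟩ := hK.isBounded.exists_norm_le
  obtain rfl | hne := K.eq_empty_or_nonempty
  · exact ⟨r + 1, r + 2, by linarith, by linarith, by simp⟩
  · obtain ⟨z, hz, hmin⟩ := hK.exists_isMinOn hne continuous_norm.continuousOn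
    have hrz : r < ‖z‖ := hs hz
    refine ⟨(r + ‖z‖) / 2, b + 1, by linarith, by linarith [hb z hz], fun x hx ↦ ⟨?_, ?_⟩⟩
    · linarith [isMinOn_iff.1 hmin x hx]
    · linarith [hb x hx]

lemma continuous_sq_div_infDist_sq [NormedSpace ℝ E] {u : E → ℝ} (hu : Continuous u) {r : ℝ}
    (hr : 0 < r) (hs : tsupport u ⊆ {x : E | r < ‖x‖}) :
    Continuous fun x ↦ u x ^ 2 / Metric.infDist x {x : E | r < ‖x‖}ᶜ ^ 2 := by
  refine ContinuousOn.continuous_of_tsupport_subset (s := {x : E | r < ‖x‖}) ?_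
    (isOpen_exterior_ball r) (subset_trans (closure_mono fun x hx ↦ ?_) hs)
  · refine ((hu.pow 2).continuousOn).div
      ((Metric.continuous_infDist_pt _).pow 2).continuousOn fun x hx ↦ ?_
    rw [infDist_compl_exterior_ball hr hx]
    exact pow_ne_zero _ (sub_pos.2 hx).ne'
  · contrapose! hx
    simp [Function.notMem_support.1 hx]

end Exterior

section HardyInequality

variable {E : Type*} [NormedAddCommGroup E] [InnerProductSpace ℝ E] [FiniteDimensional ℝ E]

lemma norm_gradient (u : E → ℝ) (x : E) : ‖gradient u x‖ = ‖fderiv ℝ u x‖ := by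
  simp [gradient]

lemma gradient_eq_zero_of_notMem_tsupport {u : E → ℝ} {x : E} (hx : x ∉ tsupport u) :
    gradient u x = 0 := by
  have := image_eq_zero_of_notMem_tsupport (fun h ↦ hx (tsupport_fderiv_subset ℝ h))
  rw [gradient, this, map_zero]

lemma continuous_gradient {u : E → ℝ} (hu : ContDiff ℝ (⊤ : ℕ∞) u) : Continuous (gradient u) :=
  (InnerProductSpace.toDual ℝ E).symm.continuous.comp (hu.continuous_fderiv (by simp))

lemma hasCompactSupport_gradient {u : E → ℝ} (hc : HasCompactSupport u) :
    HasCompactSupport (gradient u) :=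
  HasCompactSupport.intro hc fun _ hx ↦ gradient_eq_zero_of_notMem_tsupport hx

variable [MeasurableSpace E] [BorelSpace E]

/-- The Hardy inequality with constant `1 / 4` in the exterior of a ball. -/
theorem hardy_inequality_exterior_ball {k : ℕ} (hk : Module.finrank ℝ E = k + 3) {r : ℝ}
    (hr : 0 < r) {u : E → ℝ} (hu : ContDiff ℝ (⊤ : ℕ∞) u) (hc : HasCompactSupport u)
    (hs : tsupport u ⊆ {x : E | r < ‖x‖}) :
    (1 / 4 : ℝ) * ∫ x in {x : E | r < ‖x‖}, u x ^ 2 / Metric.infDist x {x : E | r < ‖x‖}ᶜ ^ 2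
      ≤ ∫ x in {x : E | r < ‖x‖}, ‖gradient u x‖ ^ 2 := by
  have : Nontrivial E := Module.nontrivial_of_finrank_pos (R := ℝ) (by omega)
  obtain ⟨a, b, hra, hab, hann⟩ := exists_annulus_of_isCompact hc hs
  set Ω : Set E := {x : E | r < ‖x‖} with hΩ
  have hzero : ∀ x ∉ Ω, x ∉ tsupport u := fun x hx h ↦ hx (hs h)
  rw [setIntegral_eq_integral_of_forall_compl_eq_zero fun x hx ↦ by
      simp [image_eq_zero_of_notMem_tsupport (hzero x hx)],
    setIntegral_eq_integral_of_forall_compl_eq_zero fun x hx ↦ by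
      simp [gradient_eq_zero_of_notMem_tsupport (hzero x hx)]]
  have c1 := continuous_sq_div_infDist_sq hu.continuous hr hs
  have c2 : Continuous fun x ↦ ‖gradient u x‖ ^ 2 := (continuous_gradient hu).norm.pow 2
  have i1 := c1.integrable_of_hasCompactSupport (μ := volume) (hasCompactSupport_sq_div hc _)
  have i2 := c2.integrable_of_hasCompactSupport (μ := volume)
    ((hasCompactSupport_gradient hc).comp_left (g := fun v ↦ ‖v‖ ^ 2) (by simp))
  rw [← sub_nonneg, ← integral_const_mul, ← integral_sub i2 (i1.const_mul _)]
  refine integral_nonneg_of_forall_ray _ (i2.sub (i1.const_mul _)) fun w hw ↦ ?_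
  have hn : Module.finrank ℝ E - 1 = k + 2 := by omega
  rw [hn]
  have hnorm : ∀ y, 0 < y → ‖y • w‖ = y := fun y hy ↦ by simp [norm_smul, hw, abs_of_pos hy]
  have hout : ∀ y, 0 < y → (y ≤ a ∨ b ≤ y) → y • w ∉ tsupport u := fun y hy h hmem ↦ by
    have := hann _ hmem
    rw [hnorm y hy] at this
    rcases h with h | h <;> linarith
  have ha : 0 < a := hr.trans hra
  rw [setIntegral_eq_of_subset_of_forall_sdiff_eq_zero (s := Set.Ioc a b) measurableSet_Ioi
    (fun y hy ↦ ha.trans hy.1) fun y hy ↦ ?_, ← intervalIntegral.integral_of_le hab.le]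
  · have hderiv : ∀ y, HasDerivAt (fun y : ℝ ↦ u (y • w)) (fderiv ℝ u (y • w) w) y := fun y ↦ by
      have h1 : HasDerivAt (fun y : ℝ ↦ y • w) w y := by
        simpa using (hasDerivAt_id y).smul_const w
      exact ((hu.differentiable (by simp)) (y • w)).hasFDerivAt.comp_hasDerivAt y h1
    choose! D hD1 hD2 using fun y (hy : r < y) ↦
      exists_hasDerivAt_le_radial_hardy k hr hy (hderiv y)
    have hFTC := intervalIntegral.sub_le_integral_of_hasDeriv_right_of_le hab.le
      (fun y hy ↦ (hD1 y (hra.trans_le hy.1)).continuousAt.continuousWithinAt)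
      (fun y hy ↦ (hD1 y (hra.trans hy.1)).hasDerivWithinAt)
      (φ := fun y ↦ y ^ (k + 2) * (‖gradient u (y • w)‖ ^ 2 -
        1 / 4 * (u (y • w) ^ 2 / Metric.infDist (y • w) Ωᶜ ^ 2)))
      (Continuous.integrableOn_Icc (by
        have c3 : Continuous fun y : ℝ ↦ y • w := by fun_prop
        exact (continuous_pow _).mul ((c2.comp c3).sub ((c1.comp c3).const_mul _))))
      (fun y hy ↦ ?_)
    · have hua : u (a • w) = 0 :=
        image_eq_zero_of_notMem_tsupport (hout a ha (.inl le_rfl))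
      have hub : u (b • w) = 0 :=
        image_eq_zero_of_notMem_tsupport (hout b (ha.trans hab) (.inr le_rfl))
      simpa [hua, hub] using hFTC
    · have hy0 : 0 < y := ha.trans hy.1
      have hry : r < y := hra.trans hy.1
      refine (hD2 y hry).trans ?_
      rw [infDist_compl_exterior_ball hr (by rwa [hnorm y hy0]), hnorm y hy0]
      gcongr ?_ * (?_ - _)
      rw [norm_gradient, ← sq_abs]
      gcongr
      simpa [hw] using (fderiv ℝ u (y • w)).le_opNorm w
  · have hy0 : 0 < y := hy.1
    have hx : y • w ∉ tsupport u := hout y hy0 (by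
      by_contra! h
      exact hy.2 ⟨h.1, h.2.le⟩)
    simp [image_eq_zero_of_notMem_tsupport hx, gradient_eq_zero_of_notMem_tsupport hx]

end HardyInequality

/-- The profile `√(y - r) * η (log (y - r) / R + 2)` of the radial functions that nearly saturate
the Hardy inequality near the sphere of radius `r`. -/
noncomputable def hardyProfile (η : ℝ → ℝ) (r R y : ℝ) : ℝ :=
  if r < y then exp (log (y - r) / 2) * η (log (y - r) / R + 2) else 0

/-- The derivative of `hardyProfile` on `(r, ∞)`. -/
noncomputable def hardyProfileDeriv (η : ℝ → ℝ) (r R y : ℝ) : ℝ :=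
  exp (log (y - r) / 2) / (y - r) *
    (η (log (y - r) / R + 2) / 2 + deriv η (log (y - r) / R + 2) / R)

lemma hardyProfile_eventuallyEq (η : ℝ → ℝ) {r y : ℝ} (R : ℝ) (hy : r < y) :
    hardyProfile η r R =ᶠ[nhds y]
      fun y ↦ exp (log (y - r) / 2) * η (log (y - r) / R + 2) := by
  filter_upwards [lt_mem_nhds hy] with z hz
  exact if_pos hz

lemma hasDerivAt_hardyProfile {η : ℝ → ℝ} (hη : Differentiable ℝ η) {r y : ℝ} (R : ℝ)
    (hy : r < y) : HasDerivAt (hardyProfile η r R) (hardyProfileDeriv η r R y) y := by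
  refine HasDerivAt.congr_of_eventuallyEq ?_ (hardyProfile_eventuallyEq η R hy)
  have hd : y - r ≠ 0 := (sub_pos.2 hy).ne'
  have hlog : HasDerivAt (fun y ↦ log (y - r)) (1 / (y - r)) y :=
    ((hasDerivAt_id y).sub_const r).log hd
  have hcomp : HasDerivAt (fun y ↦ η (log (y - r) / R + 2))
      (deriv η (log (y - r) / R + 2) * (1 / (y - r) / R)) y :=
    (hη _).hasDerivAt.comp y ((hlog.div_const R).add_const 2)
  refine ((hlog.div_const 2).exp.mul hcomp).congr_deriv ?_
  rw [hardyProfileDeriv]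
  ring

lemma contDiffAt_hardyProfile {η : ℝ → ℝ} (hη : ContDiff ℝ (⊤ : ℕ∞) η) {r y : ℝ} (R : ℝ)
    (hy : r < y) : ContDiffAt ℝ (⊤ : ℕ∞) (hardyProfile η r R) y := by
  refine ContDiffAt.congr_of_eventuallyEq ?_ (hardyProfile_eventuallyEq η R hy)
  have hlog : ContDiffAt ℝ (⊤ : ℕ∞) (fun y ↦ log (y - r)) y :=
    (contDiffAt_id.sub contDiffAt_const).log (sub_pos.2 hy).ne'
  exact (hlog.div_const 2).exp.mul
    (hη.contDiffAt.comp y ((hlog.div_const R).add contDiffAt_const))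

lemma mem_Icc_of_hardyProfile_ne_zero {η : ℝ → ℝ} (hη : ∀ s, 1 ≤ |s| → η s = 0) {r R y : ℝ}
    (hR : 0 < R) (hy : hardyProfile η r R y ≠ 0) :
    y ∈ Set.Icc (r + exp (-3 * R)) (r + exp (-R)) := by
  have hry : r < y := by
    by_contra h
    exact hy (if_neg h)
  rw [hardyProfile, if_pos hry] at hy
  have habs : |log (y - r) / R + 2| < 1 := by
    by_contra! h
    exact hy (by rw [hη _ h, mul_zero])
  obtain ⟨h1, h2⟩ := abs_lt.1 habs
  have h3 : -3 * R ≤ log (y - r) := by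
    rw [← le_div_iff₀ hR]; linarith
  have h4 : log (y - r) ≤ -R := by
    have : log (y - r) / R ≤ -1 := by linarith
    rw [div_le_iff₀ hR] at this
    linarith
  rw [Real.le_log_iff_exp_le (sub_pos.2 hry)] at h3
  rw [Real.log_le_iff_le_exp (sub_pos.2 hry)] at h4
  constructor <;> linarith

section TestFunctions

variable {E : Type*} [NormedAddCommGroup E]

lemma tsupport_hardyProfile_norm {η : ℝ → ℝ} (hη : ∀ s, 1 ≤ |s| → η s = 0) (r : ℝ) {R : ℝ}
    (hR : 0 < R) : tsupport (fun x : E ↦ hardyProfile η r R ‖x‖) ⊆ {x : E | r < ‖x‖} := by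
  have hsub : tsupport (fun x : E ↦ hardyProfile η r R ‖x‖) ⊆
      (fun x : E ↦ ‖x‖) ⁻¹' Set.Icc (r + exp (-3 * R)) (r + exp (-R)) :=
    closure_minimal (fun x hx ↦ mem_Icc_of_hardyProfile_ne_zero hη hR hx)
      (isClosed_Icc.preimage continuous_norm)
  intro x hx
  have h1 : r + exp (-3 * R) ≤ ‖x‖ := (hsub hx).1
  have h2 := exp_pos (-3 * R)
  show r < ‖x‖
  linarith

variable [InnerProductSpace ℝ E]

lemma hasCompactSupport_hardyProfile_norm [FiniteDimensional ℝ E] {η : ℝ → ℝ}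
    (hη : ∀ s, 1 ≤ |s| → η s = 0) (r : ℝ) {R : ℝ} (hR : 0 < R) :
    HasCompactSupport (fun x : E ↦ hardyProfile η r R ‖x‖) := by
  have : ProperSpace E := FiniteDimensional.proper ℝ E
  refine HasCompactSupport.of_support_subset_isCompact
    (isCompact_closedBall (0 : E) (r + exp (-R))) fun x hx ↦ ?_
  rw [mem_closedBall_zero_iff]
  exact (mem_Icc_of_hardyProfile_ne_zero hη hR hx).2

lemma contDiff_hardyProfile_norm {η : ℝ → ℝ} (hη : ContDiff ℝ (⊤ : ℕ∞) η)
    (hη0 : ∀ s, 1 ≤ |s| → η s = 0) {r R : ℝ} (hr : 0 < r) (hR : 0 < R) :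
    ContDiff ℝ (⊤ : ℕ∞) (fun x : E ↦ hardyProfile η r R ‖x‖) := by
  refine contDiff_iff_contDiffAt.2 fun x ↦ ?_
  by_cases hx : r < ‖x‖
  · exact (contDiffAt_hardyProfile hη R hx).comp x
      (contDiffAt_norm ℝ (norm_pos_iff.1 (hr.trans hx)))
  · have hx' := notMem_tsupport_iff_eventuallyEq.1
      (fun h ↦ hx (tsupport_hardyProfile_norm (E := E) hη0 r hR h))
    exact contDiffAt_const.congr_of_eventuallyEq hx'

lemma norm_gradient_hardyProfile_norm [FiniteDimensional ℝ E] [Nontrivial E] {η : ℝ → ℝ}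
    (hη : Differentiable ℝ η) {r : ℝ} (R : ℝ) (hr : 0 < r) {x : E} (hx : r < ‖x‖) :
    ‖gradient (fun x : E ↦ hardyProfile η r R ‖x‖) x‖ = |hardyProfileDeriv η r R ‖x‖| := by
  have hd : DifferentiableAt ℝ (fun x : E ↦ ‖x‖) x :=
    (contDiffAt_norm ℝ (norm_pos_iff.1 (hr.trans hx)) (n := 1)).differentiableAt (by simp)
  have := (hasDerivAt_hardyProfile hη R hx).comp_hasFDerivAt x hd.hasFDerivAt
  rw [norm_gradient, HasFDerivAt.fderiv (f := fun x : E ↦ hardyProfile η r R ‖x‖) this, norm_smul,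
    norm_fderiv_norm hd, mul_one, Real.norm_eq_abs]

end TestFunctions

/-- The substitution `y = r + exp (R * (s - 2))`. -/
lemma integral_Ioi_eq_integral_exp (r : ℝ) {R : ℝ} (hR : 0 < R) (f : ℝ → ℝ) :
    ∫ y in Set.Ioi r, f y =
      ∫ s, R * exp (R * (s - 2)) * f (r + exp (R * (s - 2))) := by
  have himage : (fun s ↦ r + exp (R * (s - 2))) '' Set.univ = Set.Ioi r := by
    ext y
    simp only [Set.image_univ, Set.mem_range, Set.mem_Ioi]
    constructor
    · rintro ⟨s, rfl⟩
      linarith [exp_pos (R * (s - 2))]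
    · intro hy
      refine ⟨log (y - r) / R + 2, ?_⟩
      rw [add_sub_cancel_right, mul_div_cancel₀ _ hR.ne', exp_log (sub_pos.2 hy)]
      ring
  have hderiv : ∀ s ∈ Set.univ, HasDerivWithinAt (fun s ↦ r + exp (R * (s - 2)))
      (R * exp (R * (s - 2))) Set.univ s := fun s _ ↦ by
    have := (((((hasDerivAt_id s).sub_const 2).const_mul R).exp).const_add r).hasDerivWithinAt
      (s := Set.univ)
    refine this.congr_deriv ?_
    simp only [id]
    ring
  have hinj : Set.InjOn (fun s ↦ r + exp (R * (s - 2))) Set.univ := by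
    intro s _ t _ h
    have h' := exp_injective (add_left_cancel h)
    have := mul_left_cancel₀ hR.ne' h'
    linarith
  rw [← himage, integral_image_eq_integral_abs_deriv_smul MeasurableSet.univ hderiv hinj,
    setIntegral_univ]
  refine integral_congr_ae (.of_forall fun s ↦ ?_)
  simp only [smul_eq_mul]
  rw [abs_of_pos (by positivity)]

/-- A radial integral over the exterior of a ball, in the variable `s` with
`‖x‖ = r + exp (R * (s - 2))`. -/
lemma integral_exterior_ball_fun_norm {E : Type*} [NormedAddCommGroup E] [NormedSpace ℝ E]
    [FiniteDimensional ℝ E] [Nontrivial E] [MeasurableSpace E] [BorelSpace E] (μ : Measure E)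
    [μ.IsAddHaarMeasure] {r R : ℝ} (hr : 0 < r) (hR : 0 < R) (f : ℝ → ℝ) :
    ∫ x in {x : E | r < ‖x‖}, f ‖x‖ ∂μ =
      (Module.finrank ℝ E * μ.real (Metric.ball 0 1)) *
        ∫ s, R * exp (R * (s - 2)) * ((r + exp (R * (s - 2))) ^ (Module.finrank ℝ E - 1) *
          f (r + exp (R * (s - 2)))) := by
  have hmeas : MeasurableSet {x : E | r < ‖x‖} :=
    (isOpen_lt continuous_const continuous_norm).measurableSet
  have h1 : ∫ x in {x : E | r < ‖x‖}, f ‖x‖ ∂μ = ∫ x, (Set.Ioi r).indicator f ‖x‖ ∂μ := by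
    rw [← integral_indicator hmeas]
    rfl
  rw [h1, integral_fun_norm_addHaar, nsmul_eq_mul, smul_eq_mul, mul_assoc,
    ← integral_Ioi_eq_integral_exp r hR fun y ↦ y ^ (Module.finrank ℝ E - 1) * f y,
    setIntegral_eq_of_subset_of_forall_sdiff_eq_zero (s := Set.Ioi r) measurableSet_Ioi
      (Set.Ioi_subset_Ioi hr.le) fun y hy ↦ by simp [Set.indicator_of_notMem hy.2],
    setIntegral_congr_fun measurableSet_Ioi fun y hy ↦ ?_]
  simp [Set.indicator_of_mem hy]

lemma exists_contDiff_cutoff : ∃ η : ℝ → ℝ, ContDiff ℝ (⊤ : ℕ∞) η ∧ HasCompactSupport η ∧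
    (∀ s, 1 ≤ |s| → η s = 0) ∧ η 0 ≠ 0 := by
  let η : ContDiffBump (0 : ℝ) := ⟨1 / 2, 1, by norm_num, by norm_num⟩
  refine ⟨η, η.contDiff, η.hasCompactSupport, fun s hs ↦ ?_, ?_⟩
  · exact η.zero_of_le_dist (by simpa [η] using hs)
  · rw [η.one_of_mem_closedBall (by simp [η])]
    exact one_ne_zero

lemma deriv_eq_zero_of_one_lt_abs {η : ℝ → ℝ} (hη : ∀ s, 1 ≤ |s| → η s = 0) {s : ℝ}
    (hs : 1 < |s|) : deriv η s = 0 := by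
  have : η =ᶠ[nhds s] fun _ ↦ 0 := by
    filter_upwards [continuous_abs.continuousAt.eventually (lt_mem_nhds hs)] with t ht
    exact hη t ht.le
  rw [this.deriv_eq, deriv_const]

lemma hasCompactSupport_fun_sq {f : ℝ → ℝ} (hc : HasCompactSupport f) :
    HasCompactSupport fun s ↦ f s ^ 2 :=
  HasCompactSupport.intro hc fun s hs ↦ by simp [image_eq_zero_of_notMem_tsupport hs]

lemma integrable_sq_of_hasCompactSupport {f : ℝ → ℝ} (hf : Continuous f)
    (hc : HasCompactSupport f) : Integrable fun s ↦ f s ^ 2 := by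
  have hsq : Continuous fun s ↦ f s ^ 2 := by fun_prop
  exact hsq.integrable_of_hasCompactSupport (hasCompactSupport_fun_sq hc)

lemma hasCompactSupport_half_add_deriv_div {η : ℝ → ℝ} (hc : HasCompactSupport η) (R : ℝ) :
    HasCompactSupport fun s ↦ η s / 2 + deriv η s / R :=
  HasCompactSupport.add (hc.comp_left (g := fun t ↦ t / 2) (by simp))
    (hc.deriv.comp_left (g := fun t ↦ t / R) (by simp))

lemma pow_mul_integral_sq_le {η : ℝ → ℝ} (hη : Continuous η) (hc : HasCompactSupport η) (m : ℕ)
    {r : ℝ} (hr : 0 ≤ r) (R : ℝ) :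
    r ^ m * ∫ s, η s ^ 2 ≤ ∫ s, (r + exp (R * (s - 2))) ^ m * η s ^ 2 := by
  have hcont : Continuous fun s ↦ (r + exp (R * (s - 2))) ^ m * η s ^ 2 := by fun_prop
  have hint : Integrable fun s ↦ (r + exp (R * (s - 2))) ^ m * η s ^ 2 :=
    hcont.integrable_of_hasCompactSupport (hasCompactSupport_fun_sq hc).mul_left
  rw [← integral_const_mul]
  refine integral_mono ((integrable_sq_of_hasCompactSupport hη hc).const_mul _) hint fun s ↦ ?_
  exact mul_le_mul_of_nonneg_right
    (pow_le_pow_left₀ hr (by linarith [exp_pos (R * (s - 2))]) m) (sq_nonneg _)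

lemma integral_weight_mul_sq_le {η : ℝ → ℝ} (hη : ContDiff ℝ (⊤ : ℕ∞) η)
    (hc : HasCompactSupport η) (hη0 : ∀ s, 1 ≤ |s| → η s = 0) (m : ℕ) {r R : ℝ} (hr : 0 ≤ r)
    (hR : 0 < R) :
    ∫ s, (r + exp (R * (s - 2))) ^ m * (η s / 2 + deriv η s / R) ^ 2 ≤
      (r + exp (-R)) ^ m * ∫ s, (η s / 2 + deriv η s / R) ^ 2 := by
  have hcont : Continuous fun s ↦ η s / 2 + deriv η s / R :=
    (hη.continuous.div_const 2).add ((hη.continuous_deriv (by simp)).div_const R)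
  have hint := integrable_sq_of_hasCompactSupport hcont (hasCompactSupport_half_add_deriv_div hc R)
  rw [← integral_const_mul]
  refine integral_mono_of_nonneg (.of_forall fun s ↦ ?_) (hint.const_mul _)
    (.of_forall fun s ↦ ?_)
  · exact mul_nonneg (pow_nonneg (add_nonneg hr (exp_pos _).le) _) (sq_nonneg _)
  · rcases le_or_gt |s| 1 with hs | hs
    · refine mul_le_mul_of_nonneg_right (pow_le_pow_left₀ (add_nonneg hr (exp_pos _).le) ?_ m)
        (sq_nonneg _)
      have : R * (s - 2) ≤ -R := by nlinarith [le_abs_self s]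
      linarith [exp_le_exp.2 this]
    · simp [hη0 s hs.le, deriv_eq_zero_of_one_lt_abs hη0 hs]

lemma tendsto_integral_sq_half_add_deriv_div {η : ℝ → ℝ} (hη : ContDiff ℝ (⊤ : ℕ∞) η)
    (hc : HasCompactSupport η) :
    Filter.Tendsto (fun R : ℝ ↦ ∫ s, (η s / 2 + deriv η s / R) ^ 2) Filter.atTop
      (nhds (1 / 4 * ∫ s, η s ^ 2)) := by
  have hη' : Continuous (deriv η) := hη.continuous_deriv (by simp)
  have iA := integrable_sq_of_hasCompactSupport hη.continuous hc
  have iB := integrable_sq_of_hasCompactSupport hη' hc.deriv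
  have iD : Integrable fun s ↦ η s * deriv η s :=
    (hη.continuous.mul hη').integrable_of_hasCompactSupport hc.mul_right
  have hexpand : ∀ R : ℝ, ∫ s, (η s / 2 + deriv η s / R) ^ 2 =
      1 / 4 * (∫ s, η s ^ 2) + (∫ s, η s * deriv η s) * R⁻¹ + (∫ s, deriv η s ^ 2) * R⁻¹ ^ 2 := by
    intro R
    have iAD : Integrable fun s ↦ 1 / 4 * η s ^ 2 + η s * deriv η s * R⁻¹ :=
      (iA.const_mul _).add (iD.mul_const _)
    rw [← integral_const_mul, ← integral_mul_const, ← integral_mul_const,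
      ← integral_add (iA.const_mul _) (iD.mul_const _), ← integral_add iAD (iB.mul_const _)]
    congr 1 with s
    ring
  simp_rw [hexpand]
  simpa using ((tendsto_inv_atTop_zero (𝕜 := ℝ)).const_mul (∫ s, η s * deriv η s)).const_add
    (1 / 4 * ∫ s, η s ^ 2) |>.add
      (((tendsto_inv_atTop_zero (𝕜 := ℝ)).pow 2).const_mul (∫ s, deriv η s ^ 2))

section Sharpness

variable {E : Type*} [NormedAddCommGroup E] [InnerProductSpace ℝ E] [FiniteDimensional ℝ E]
  [Nontrivial E] [MeasurableSpace E] [BorelSpace E]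

lemma setIntegral_hardyProfile_sq_div (η : ℝ → ℝ) {r R : ℝ} (hr : 0 < r) (hR : 0 < R) :
    ∫ x in {x : E | r < ‖x‖},
        hardyProfile η r R ‖x‖ ^ 2 / Metric.infDist x {x : E | r < ‖x‖}ᶜ ^ 2 =
      (Module.finrank ℝ E * volume.real (Metric.ball (0 : E) 1)) *
        (R * ∫ s, (r + exp (R * (s - 2))) ^ (Module.finrank ℝ E - 1) * η s ^ 2) := by
  rw [setIntegral_congr_fun (isOpen_exterior_ball r).measurableSet
    (g := fun x : E ↦ (fun y ↦ hardyProfile η r R y ^ 2 / (y - r) ^ 2) ‖x‖) fun x hx ↦ by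
      simp only [infDist_compl_exterior_ball hr hx],
    integral_exterior_ball_fun_norm volume hr hR
      (fun y ↦ hardyProfile η r R y ^ 2 / (y - r) ^ 2), ← integral_const_mul R]
  congr 2 with s
  have hs : r < r + exp (R * (s - 2)) := by linarith [exp_pos (R * (s - 2))]
  rw [hardyProfile, if_pos hs, add_sub_cancel_left, log_exp, mul_div_cancel_left₀ _ hR.ne',
    sub_add_cancel, mul_pow, ← exp_nat_mul]
  have : ((2 : ℕ) : ℝ) * (R * (s - 2) / 2) = R * (s - 2) := by push_cast; ring
  rw [this]
  field_simp

lemma setIntegral_norm_gradient_hardyProfile_sq {η : ℝ → ℝ} (hη : Differentiable ℝ η) {r R : ℝ}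
    (hr : 0 < r) (hR : 0 < R) :
    ∫ x in {x : E | r < ‖x‖}, ‖gradient (fun x : E ↦ hardyProfile η r R ‖x‖) x‖ ^ 2 =
      (Module.finrank ℝ E * volume.real (Metric.ball (0 : E) 1)) *
        (R * ∫ s, (r + exp (R * (s - 2))) ^ (Module.finrank ℝ E - 1) *
          (η s / 2 + deriv η s / R) ^ 2) := by
  rw [setIntegral_congr_fun (isOpen_exterior_ball r).measurableSet
    (g := fun x : E ↦ (fun y ↦ hardyProfileDeriv η r R y ^ 2) ‖x‖) fun x hx ↦ by
      simp only [norm_gradient_hardyProfile_norm hη R hr hx, sq_abs],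
    integral_exterior_ball_fun_norm volume hr hR
      (fun y ↦ hardyProfileDeriv η r R y ^ 2), ← integral_const_mul R]
  congr 2 with s
  rw [hardyProfileDeriv, add_sub_cancel_left, log_exp, mul_div_cancel_left₀ _ hR.ne',
    sub_add_cancel, mul_pow, div_pow, ← exp_nat_mul]
  have : ((2 : ℕ) : ℝ) * (R * (s - 2) / 2) = R * (s - 2) := by push_cast; ring
  rw [this]
  field_simp

/-- The constant `1 / 4` in the Hardy inequality in the exterior of a ball is optimal. -/
theorem le_of_hardy_inequality_exterior_ball {r : ℝ} (hr : 0 < r) {c : ℝ}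
    (h : ∀ u : E → ℝ, ContDiff ℝ (⊤ : ℕ∞) u → HasCompactSupport u →
      tsupport u ⊆ {x : E | r < ‖x‖} →
      c * ∫ x in {x : E | r < ‖x‖}, u x ^ 2 / Metric.infDist x {x : E | r < ‖x‖}ᶜ ^ 2
        ≤ ∫ x in {x : E | r < ‖x‖}, ‖gradient u x‖ ^ 2) : c ≤ 1 / 4 := by
  by_contra! hc
  have hc0 : 0 < c := by linarith
  obtain ⟨η, hη, hηc, hη0, hη1⟩ := exists_contDiff_cutoff
  have hcont : Continuous fun s ↦ η s ^ 2 := by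
    have := hη.continuous
    fun_prop
  have hA : 0 < ∫ s, η s ^ 2 := hcont.integral_pos_of_hasCompactSupport_nonneg_nonzero
    (hasCompactSupport_fun_sq hηc) (fun s ↦ sq_nonneg (η s)) (pow_ne_zero 2 hη1)
  have hvol : 0 < Module.finrank ℝ E * volume.real (Metric.ball (0 : E) 1) :=
    mul_pos (Nat.cast_pos.2 Module.finrank_pos)
      (ENNReal.toReal_pos (Metric.measure_ball_pos _ _ one_pos).ne' measure_ball_lt_top.ne)
  have bound : ∀ R : ℝ, 0 < R → c * (r ^ (Module.finrank ℝ E - 1) * ∫ s, η s ^ 2) ≤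
      (r + exp (-R)) ^ (Module.finrank ℝ E - 1) * ∫ s, (η s / 2 + deriv η s / R) ^ 2 := by
    intro R hR
    have hmain := h _ (contDiff_hardyProfile_norm hη hη0 hr hR)
      (hasCompactSupport_hardyProfile_norm hη0 r hR) (tsupport_hardyProfile_norm hη0 r hR)
    rw [setIntegral_hardyProfile_sq_div η hr hR,
      setIntegral_norm_gradient_hardyProfile_sq (hη.differentiable (by simp)) hr hR,
      mul_left_comm, mul_left_comm c] at hmain
    replace hmain := le_of_mul_le_mul_left (le_of_mul_le_mul_left hmain hvol) hR
    exact (mul_le_mul_of_nonneg_left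
      (pow_mul_integral_sq_le hη.continuous hηc _ hr.le R) hc0.le).trans
        (hmain.trans (integral_weight_mul_sq_le hη hηc hη0 _ hr.le hR))
  generalize Module.finrank ℝ E - 1 = m at bound
  have hlim : Filter.Tendsto
      (fun R : ℝ ↦ (r + exp (-R)) ^ m * ∫ s, (η s / 2 + deriv η s / R) ^ 2) Filter.atTop
      (nhds ((r + 0) ^ m * (1 / 4 * ∫ s, η s ^ 2))) :=
    ((tendsto_exp_neg_atTop_nhds_zero.const_add r).pow m).mul
      (tendsto_integral_sq_half_add_deriv_div hη hηc)
  have hle := ge_of_tendsto hlim (Filter.eventually_atTop.2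
    ⟨1, fun R hR ↦ bound R (one_pos.trans_le hR)⟩)
  have hrA : 0 < r ^ m * ∫ s, η s ^ 2 := by positivity
  have := mul_lt_mul_of_pos_right hc hrA
  rw [add_zero] at hle
  linarith

end Sharpness

/-- **The Hardy constant of the exterior of a ball is 1/4.**
For `n ≥ 3` and `r > 0`, the exterior domain `Ω = {x ∈ ℝⁿ : |x| > r}` satisfies
`∫_Ω ‖∇u‖² ≥ (1/4) ∫_Ω u²/d²` for all `u ∈ C_c^∞(Ω)`, and `1/4` is the largest constant
for which this holds. -/
theorem hardy_constant_exterior_ball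
    (n : ℕ) (hn : 3 ≤ n) (r : ℝ) (hr : 0 < r)
    (Ω : Set (EuclideanSpace ℝ (Fin n)))
    (hΩ : Ω = {x : EuclideanSpace ℝ (Fin n) | r < ‖x‖}) :
    (∀ u : EuclideanSpace ℝ (Fin n) → ℝ,
        ContDiff ℝ (⊤ : ℕ∞) u → HasCompactSupport u → tsupport u ⊆ Ω →
        (1 / 4 : ℝ) * ∫ x in Ω, u x ^ 2 / Metric.infDist x Ωᶜ ^ 2
          ≤ ∫ x in Ω, ‖gradient u x‖ ^ 2) ∧
    (∀ c : ℝ,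
      (∀ u : EuclideanSpace ℝ (Fin n) → ℝ,
        ContDiff ℝ (⊤ : ℕ∞) u → HasCompactSupport u → tsupport u ⊆ Ω →
        c * ∫ x in Ω, u x ^ 2 / Metric.infDist x Ωᶜ ^ 2
          ≤ ∫ x in Ω, ‖gradient u x‖ ^ 2) → c ≤ 1 / 4) := by
  obtain ⟨k, rfl⟩ := Nat.exists_eq_add_of_le' hn
  have hdim : Module.finrank ℝ (EuclideanSpace ℝ (Fin (k + 3))) = k + 3 := by simp
  subst hΩ
  exact ⟨fun u hu hc hs ↦ hardy_inequality_exterior_ball hdim hr hu hc hs,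
    fun c h ↦ le_of_hardy_inequality_exterior_ball hr h⟩
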